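/- Let k be a field, n ≥ 1, d = (d_1,…,d_n) ∈ ℕ^n, and φ = (φ_i) ∈ E(d) a representation of Δ_n. For 1 ≤ t ≤ n and 1 ≤ i ≤ n set d^{(t)}_i = dim ker(φ_{i+t−1} ∘ ⋯ ∘ φ_i) − dim ker(φ_{i+t−2} ∘ ⋯ ∘ φ_i), with the convention that φ_j is the zero map to the zero space for j ≥ n (so the composition of t maps starting at vertex i is zero whenever i + t − 1 ≥ n), and set d^{(t)}_0 = 0. Then the space of quiver endomorphisms End(φ) = { (ξ_i) ∈ ⊕_{i=1}^n End_k(k^{d_i}) : ξ_{i+1} ∘ φ_i = φ_i ∘ ξ_i for 1 ≤ i ≤ n−1 } has dimension Σ_{i=1}^n d_i² − Σ_{i=1}^n Σ_{1 ≤ s < t ≤ n} d^{(s)}_i (d^{(t)}_i + d^{(t)}_{i−1}). (Equivalently, the G_d-orbit of φ has dimension Σ_i Σ_{s<t} d^{(s)}_i (d^{(t)}_i + d^{(t)}_{i−1}), since the orbit dimension is dim G_d − dim End(φ).) -/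

import Mathlib

open Module LinearMap Finset

/-- The composition `φ_{i+t-1} ∘ ⋯ ∘ φ_{i+1} ∘ φ_i` of `t` consecutive structure
maps of a representation of an equioriented quiver of type `A`, starting at
vertex `i`. -/
def comps {k : Type*} [Field k] {V : ℕ → Type*}
    [∀ i, AddCommGroup (V i)] [∀ i, Module k (V i)]
    (φ : ∀ i : ℕ, V i →ₗ[k] V (i + 1)) (i : ℕ) : ∀ t : ℕ, V i →ₗ[k] V (i + t)
  | 0 => LinearMap.id
  | t + 1 => (φ (i + t)).comp (comps φ i t)

/-- The kernel-jump dimension vectors of a representation `φ` of `Δ_n`: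
`d^{(t)}ᵢ = dim ker(φ_{i+t-1} ∘ ⋯ ∘ φᵢ) − dim ker(φ_{i+t-2} ∘ ⋯ ∘ φᵢ)`. -/
noncomputable def kerJump {k : Type*} [Field k] (d : ℕ → ℕ)
    (φ : ∀ i : ℕ, (Fin (d i) → k) →ₗ[k] (Fin (d (i + 1)) → k))
    (t i : ℕ) : ℕ :=
  finrank k (LinearMap.ker (comps φ i t))
    - finrank k (LinearMap.ker (comps φ i (t - 1)))

section FilteredHom

variable {k X Y Z : Type*} [Field k] [AddCommGroup X] [Module k X] [AddCommGroup Y] [Module k Y]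
  [AddCommGroup Z] [Module k Z]

theorem exists_comp_eq_of_ker_le (q : X →ₗ[k] Y) (h : X →ₗ[k] Z)
    (hqh : LinearMap.ker q ≤ LinearMap.ker h) : ∃ l : Y →ₗ[k] Z, l ∘ₗ q = h := by
  obtain ⟨r, hr⟩ := ((LinearMap.ker q).liftQ q le_rfl).exists_leftInverse_of_injective
    ((LinearMap.ker q).ker_liftQ_eq_bot _ le_rfl le_rfl)
  refine ⟨(LinearMap.ker q).liftQ h hqh ∘ₗ r, LinearMap.ext fun x => ?_⟩
  have hx := LinearMap.congr_fun hr ((LinearMap.ker q).mkQ x)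
  simp only [LinearMap.comp_apply, Submodule.mkQ_apply, Submodule.liftQ_apply,
    LinearMap.id_apply] at hx ⊢
  rw [hx, Submodule.liftQ_apply]

theorem finrank_map_add_finrank_inf_ker [FiniteDimensional k X] (H : Submodule k X)
    (f : X →ₗ[k] Y) :
    finrank k (H.map f) + finrank k (H ⊓ LinearMap.ker f : Submodule k X) = finrank k H := by
  have hr : LinearMap.range (f ∘ₗ H.subtype) = H.map f := by
    rw [LinearMap.range_comp, Submodule.range_subtype]
  have hk : (LinearMap.ker (f ∘ₗ H.subtype)).map H.subtype = H ⊓ LinearMap.ker f := by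
    rw [LinearMap.ker_comp, Submodule.map_comap_subtype]
  rw [← LinearMap.finrank_range_add_finrank_ker (f ∘ₗ H.subtype), hr, ← hk,
    Submodule.finrank_map_subtype_eq]

/-- The linear maps sending each step of the filtration `F` into the corresponding step of `G`. -/
def filteredHom (F : ℕ → Submodule k X) (G : ℕ → Submodule k Y) : Submodule k (X →ₗ[k] Y) where
  carrier := {f | ∀ t, ∀ x ∈ F t, f x ∈ G t}
  add_mem' hf hg t x hx := (G t).add_mem (hf t x hx) (hg t x hx)
  zero_mem' t _ _ := (G t).zero_mem
  smul_mem' c _ hf t x hx := (G t).smul_mem c (hf t x hx)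

theorem exists_filteredHom_comp_eq {F : ℕ → Submodule k X} {G : ℕ → Submodule k Y}
    (hF : Monotone F) (hG : Monotone G) {N : ℕ} (hN : F N = ⊤) (φ : Z →ₗ[k] X) (g : Z →ₗ[k] Y)
    (hG0 : G 0 = ⊥) (hg : ∀ t z, φ z ∈ F t → g z ∈ G t) :
    ∃ f ∈ filteredHom F G, f ∘ₗ φ = g := by
  have key : ∀ m, ∃ f : X →ₗ[k] Y, (∀ x, f x ∈ G m) ∧ (∀ t ≤ m, ∀ x ∈ F t, f x ∈ G t) ∧
      ∀ z, φ z ∈ F m → f (φ z) = g z := by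
    intro m
    induction m with
    | zero =>
      refine ⟨0, fun x => (G 0).zero_mem, fun t _ x _ => (G t).zero_mem, fun z hz => ?_⟩
      have := hg 0 z hz
      rw [hG0, Submodule.mem_bot] at this
      simp [this]
    | succ m ih =>
      obtain ⟨f, hf, hft, hfg⟩ := ih
      have hm := hG m.le_succ
      let A : Submodule k Z := (F (m + 1)).comap φ
      let h : A →ₗ[k] G (m + 1) := ((g - f ∘ₗ φ) ∘ₗ A.subtype).codRestrict (G (m + 1)) fun z =>
        (G (m + 1)).sub_mem (hg _ _ z.2) (hm (hf _))
      obtain ⟨l, hl⟩ := exists_comp_eq_of_ker_le ((F m).mkQ ∘ₗ φ ∘ₗ A.subtype) h (by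
        intro z hz
        have hz' : φ z ∈ F m := by simpa using hz
        simp [h, hfg _ hz'])
      have hl0 : ∀ x ∈ F m, l (Submodule.Quotient.mk x) = 0 := fun x hx => by
        rw [(Submodule.Quotient.mk_eq_zero _).2 hx, map_zero]
      refine ⟨f + (G (m + 1)).subtype ∘ₗ l ∘ₗ (F m).mkQ, fun x => ?_, fun t ht x hx => ?_,
        fun z hz => ?_⟩
      · exact (G (m + 1)).add_mem (hm (hf x)) (Subtype.prop _)
      · obtain ht | rfl := Nat.le_succ_iff.1 ht
        · simpa [hl0 x (hF ht hx)] using hft t ht x hx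
        · exact (G (m + 1)).add_mem (hm (hf x)) (Subtype.prop _)
      · have := congrArg Subtype.val (LinearMap.congr_fun hl ⟨z, hz⟩)
        simp only [LinearMap.comp_apply, Submodule.subtype_apply, h,
          LinearMap.codRestrict_apply, LinearMap.sub_apply] at this
        simp only [LinearMap.add_apply, LinearMap.comp_apply, Submodule.subtype_apply, this]
        abel
  obtain ⟨f, hf, hft, hfg⟩ := key N
  refine ⟨f, fun t x hx => ?_, LinearMap.ext fun z => hfg z (by simp [hN])⟩
  obtain ht | ht := le_total t N
  · exact hft t ht x hx
  · exact hG ht (hf x)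

theorem finrank_filteredHom [FiniteDimensional k X] [FiniteDimensional k Y]
    {F : ℕ → Submodule k X} {G : ℕ → Submodule k Y} (hF : Monotone F) (hG : Monotone G)
    {N : ℕ} (hN : F N = ⊤) (hF0 : F 0 = ⊥) :
    finrank k (filteredHom F G) =
      ∑ t ∈ Finset.range N, (finrank k (F (t + 1)) - finrank k (F t)) * finrank k (G (t + 1)) := by
  let H : ℕ → Submodule k (X →ₗ[k] Y) := fun m =>
    filteredHom F G ⊓ LinearMap.ker (LinearMap.lcomp k Y (F m).subtype)
  have mem_H : ∀ m f, f ∈ H m ↔ f ∈ filteredHom F G ∧ ∀ x ∈ F m, f x = 0 := fun m f => by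
    simp [H, LinearMap.ext_iff]
  have step : ∀ m, finrank k (H m) =
      (finrank k (F (m + 1)) - finrank k (F m)) * finrank k (G (m + 1)) + finrank k (H (m + 1)) := by
    intro m
    obtain ⟨D, hD⟩ := (F m).exists_isCompl
    let C : Submodule k X := D ⊓ F (m + 1)
    have hsup : F m ⊔ C = F (m + 1) := by
      rw [← sup_inf_assoc_of_le D (hF m.le_succ), hD.sup_eq_top, top_inf_eq]
    have hinf : F m ⊓ C = ⊥ := by
      rw [← inf_assoc, hD.inf_eq_bot, bot_inf_eq]
    have hC : finrank k C = finrank k (F (m + 1)) - finrank k (F m) := by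
      have := Submodule.finrank_sup_add_finrank_inf_eq (F m) C
      rw [hsup, hinf, finrank_bot] at this
      omega
    let Θ : (X →ₗ[k] Y) →ₗ[k] (C →ₗ[k] Y) := LinearMap.lcomp k Y C.subtype
    let J : (C →ₗ[k] G (m + 1)) →ₗ[k] (C →ₗ[k] Y) :=
      LinearMap.llcomp k C (G (m + 1)) Y (G (m + 1)).subtype
    have hJ : Function.Injective J := fun a b hab => LinearMap.ext fun c =>
      Subtype.ext (LinearMap.congr_fun hab c)
    have hmap : (H m).map Θ = LinearMap.range J := by
      ext h
      constructor
      · rintro ⟨f, hf, rfl⟩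
        exact ⟨(f ∘ₗ C.subtype).codRestrict _ fun c => ((mem_H m f).1 hf).1 _ _ c.2.2,
          LinearMap.ext fun c => rfl⟩
      · rintro ⟨h, rfl⟩
        obtain ⟨l, hl⟩ := exists_comp_eq_of_ker_le ((F m).mkQ ∘ₗ C.subtype) h (by
          intro c hc
          have hc' : (c : X) ∈ F m ⊓ C := ⟨by simpa using hc, c.2⟩
          rw [hinf, Submodule.mem_bot] at hc'
          rw [LinearMap.mem_ker, Submodule.coe_eq_zero.1 hc', map_zero])
        have hl0 : ∀ x ∈ F m, l (Submodule.Quotient.mk x) = 0 := fun x hx => by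
          rw [(Submodule.Quotient.mk_eq_zero _).2 hx, map_zero]
        refine ⟨(G (m + 1)).subtype ∘ₗ l ∘ₗ (F m).mkQ, (mem_H m _).2 ⟨fun t x hx => ?_,
          fun x hx => ?_⟩, LinearMap.ext fun c =>
            congrArg Subtype.val (LinearMap.congr_fun hl c)⟩
        · obtain ht | ht := Nat.lt_or_ge m t
          · exact hG ht (Subtype.prop _)
          · simp [hl0 x (hF ht hx)]
        · simp [hl0 x hx]
    have hker : H m ⊓ LinearMap.ker Θ = H (m + 1) := by
      ext f
      rw [Submodule.mem_inf, mem_H, mem_H, and_assoc, LinearMap.mem_ker]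
      refine and_congr_right fun _ => ⟨fun ⟨h₁, h₂⟩ x hx => ?_, fun h => ⟨fun x hx =>
        h x (hF m.le_succ hx), LinearMap.ext fun c => h c c.2.2⟩⟩
      rw [← hsup] at hx
      obtain ⟨y, hy, z, hz, rfl⟩ := Submodule.mem_sup.1 hx
      rw [map_add, h₁ y hy, zero_add]
      exact LinearMap.congr_fun h₂ ⟨z, hz⟩
    rw [← finrank_map_add_finrank_inf_ker (H m) Θ, hmap, hker,
      LinearMap.finrank_range_of_inj hJ, Module.finrank_linearMap, hC]
  have hH0 : H 0 = filteredHom F G := by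
    ext f
    simp +contextual [mem_H, hF0]
  have hHN : H N = ⊥ := by
    ext f
    rw [mem_H, Submodule.mem_bot]
    refine ⟨fun hf => LinearMap.ext fun x => hf.2 x (by simp [hN]), ?_⟩
    rintro rfl
    exact ⟨Submodule.zero_mem _, fun _ _ => rfl⟩
  have sum : ∀ m, finrank k (H 0) = ∑ t ∈ Finset.range m,
      (finrank k (F (t + 1)) - finrank k (F t)) * finrank k (G (t + 1)) + finrank k (H m) := by
    intro m
    induction m with
    | zero => simp
    | succ m ih => rw [ih, step, Finset.sum_range_succ, add_assoc]
  rw [← hH0, sum N, hHN, finrank_bot, add_zero]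

end FilteredHom

section PiNat

variable {k : Type*} [Field k] {A : ℕ → Type*} [∀ i, AddCommGroup (A i)] [∀ i, Module k (A i)]

/-- A product over `ℕ` whose factors of index at least `m` are trivial is a finite product. -/
noncomputable def piNatEquivPiFin (m : ℕ) (hA : ∀ i, m ≤ i → Subsingleton (A i)) :
    (∀ i, A i) ≃ₗ[k] ∀ i : Fin m, A i :=
  LinearEquiv.ofBijective (LinearMap.pi fun i : Fin m => LinearMap.proj (i : ℕ)) <| by
    refine ⟨fun a b hab => funext fun i => ?_, fun a => ?_⟩
    · obtain hi | hi := Nat.lt_or_ge i m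
      · exact congrFun hab ⟨i, hi⟩
      · exact (hA i hi).elim _ _
    · exact ⟨fun i => if hi : i < m then a ⟨i, hi⟩ else 0, funext fun i => by simp⟩

theorem finiteDimensional_pi_nat (m : ℕ) (hA : ∀ i, m ≤ i → Subsingleton (A i))
    [∀ i, FiniteDimensional k (A i)] : FiniteDimensional k (∀ i, A i) :=
  Module.Finite.equiv (piNatEquivPiFin m hA).symm

theorem finrank_pi_nat_submodule (m : ℕ) (hA : ∀ i, m ≤ i → Subsingleton (A i))
    [∀ i, FiniteDimensional k (A i)] (P : ∀ i, Submodule k (A i)) :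
    finrank k (Submodule.pi Set.univ P) = ∑ i ∈ Finset.range m, finrank k (P i) := by
  let e : Submodule.pi Set.univ P ≃ₗ[k] ∀ i, P i :=
    { toFun := fun f i => ⟨f.1 i, f.2 i trivial⟩
      invFun := fun f => ⟨fun i => f i, fun i _ => (f i).2⟩
      map_add' := fun _ _ => rfl
      map_smul' := fun _ _ => rfl }
  rw [(e.trans (piNatEquivPiFin m fun i hi => have := hA i hi; inferInstance)).finrank_eq,
    Module.finrank_pi_fintype, Finset.sum_range]

end PiNat

section Comps

variable {k : Type*} [Field k] {V : ℕ → Type*} [∀ i, AddCommGroup (V i)] [∀ i, Module k (V i)]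
  (φ : ∀ i : ℕ, V i →ₗ[k] V (i + 1))

theorem heq_comps_succ (i t : ℕ) (x : V i) :
    HEq (comps φ i (t + 1) x) (comps φ (i + 1) t (φ i x)) := by
  have congr_map : ∀ {j j' : ℕ} (_ : j = j') {a : V j} {b : V j'}, HEq a b →
      HEq (φ j a) (φ j' b) := by
    rintro j _ rfl a _ ⟨⟩
    rfl
  induction t with
  | zero => rfl
  | succ t ih => exact congr_map (by omega) ih

theorem mem_ker_comps_succ (i t : ℕ) (x : V i) :
    x ∈ LinearMap.ker (comps φ i (t + 1)) ↔ φ i x ∈ LinearMap.ker (comps φ (i + 1) t) := by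
  have eq_zero_congr : ∀ {j j' : ℕ} (_ : j = j') {a : V j} {b : V j'}, HEq a b →
      (a = 0 ↔ b = 0) := by
    rintro j _ rfl a _ ⟨⟩
    rfl
  exact eq_zero_congr (by omega) (heq_comps_succ φ i t x)

theorem ker_comps_zero (i : ℕ) : LinearMap.ker (comps φ i 0) = ⊥ := LinearMap.ker_id

theorem monotone_ker_comps (i : ℕ) : Monotone fun t => LinearMap.ker (comps φ i t) :=
  monotone_nat_of_le_succ fun t => LinearMap.ker_le_ker_comp (comps φ i t) (φ (i + t))

theorem comps_comm {ξ : ∀ i, V i →ₗ[k] V i} (hξ : ∀ i, ξ (i + 1) ∘ₗ φ i = φ i ∘ₗ ξ i)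
    (i t : ℕ) (x : V i) : comps φ i t (ξ i x) = ξ (i + t) (comps φ i t x) := by
  induction t with
  | zero => rfl
  | succ t ih =>
    change φ (i + t) (comps φ i t (ξ i x)) = ξ (i + t + 1) (φ (i + t) (comps φ i t x))
    rw [ih]
    exact (LinearMap.congr_fun (hξ (i + t)) _).symm

/-- The map `ξ ↦ (ξ_{i+1} ∘ φ_i - φ_i ∘ ξ_i)_i`, whose kernel consists of the quiver
endomorphisms of `φ`. -/
def quiverCommutator : (∀ i, V i →ₗ[k] V i) →ₗ[k] ∀ i, V i →ₗ[k] V (i + 1) where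
  toFun ξ i := ξ (i + 1) ∘ₗ φ i - φ i ∘ₗ ξ i
  map_add' ξ η := by
    ext i x
    simp only [Pi.add_apply, LinearMap.sub_apply, LinearMap.comp_apply, LinearMap.add_apply,
      map_add]
    abel
  map_smul' c ξ := by
    ext i x
    simp [smul_sub]

theorem mem_ker_quiverCommutator (ξ : ∀ i, V i →ₗ[k] V i) :
    ξ ∈ LinearMap.ker (quiverCommutator φ) ↔ ∀ i, ξ (i + 1) ∘ₗ φ i = φ i ∘ₗ ξ i := by
  simp [quiverCommutator, funext_iff, sub_eq_zero]

/-- The endomorphisms of `V i` preserving the filtration by kernels of the compositions of `φ`. -/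
abbrev kerPreserving (i : ℕ) : Submodule k (V i →ₗ[k] V i) :=
  filteredHom (fun t => LinearMap.ker (comps φ i t)) fun t => LinearMap.ker (comps φ i t)

/-- The linear maps `V i → V (i + 1)` lowering the filtration by kernels by one step. -/
abbrev kerLowering (i : ℕ) : Submodule k (V i →ₗ[k] V (i + 1)) :=
  filteredHom (fun t => LinearMap.ker (comps φ i t)) fun t => LinearMap.ker (comps φ (i + 1) (t - 1))

theorem ker_quiverCommutator_le :
    LinearMap.ker (quiverCommutator φ) ≤ Submodule.pi Set.univ (kerPreserving φ) := by
  intro ξ hξ i _ t x hx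
  rw [mem_ker_quiverCommutator] at hξ
  rw [LinearMap.mem_ker] at hx ⊢
  rw [comps_comm φ hξ, hx, map_zero]

theorem exists_extend_kerPreserving {N : ℕ} (hN : ∀ i, LinearMap.ker (comps φ i N) = ⊤) (i : ℕ)
    {f : V i →ₗ[k] V (i + 1)} (hf : f ∈ kerLowering φ i) {ξ : V i →ₗ[k] V i}
    (hξ : ξ ∈ kerPreserving φ i) :
    ∃ η ∈ kerPreserving φ (i + 1), η ∘ₗ φ i - φ i ∘ₗ ξ = f := by
  obtain ⟨η, hη, h⟩ := exists_filteredHom_comp_eq (monotone_ker_comps φ (i + 1))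
    (monotone_ker_comps φ (i + 1)) (hN (i + 1)) (φ i) (f + φ i ∘ₗ ξ)
    (ker_comps_zero φ _) (by
      intro t z hz
      have hz' := (mem_ker_comps_succ φ i t z).2 hz
      exact Submodule.add_mem _ (hf (t + 1) z hz')
        ((mem_ker_comps_succ φ i t _).1 (hξ (t + 1) z hz')))
  exact ⟨η, hη, by rw [h, add_sub_cancel_right]⟩

theorem map_quiverCommutator {N : ℕ} (hN : ∀ i, LinearMap.ker (comps φ i N) = ⊤) :
    (Submodule.pi Set.univ (kerPreserving φ)).map (quiverCommutator φ) =
      Submodule.pi Set.univ (kerLowering φ) := by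
  apply le_antisymm
  · rintro _ ⟨ξ, hξ, rfl⟩ i _ t x hx
    refine Submodule.sub_mem _ (hξ (i + 1) trivial _ _ ?_) ?_
    all_goals obtain _ | t := t
    · rw [show x = 0 from hx, map_zero]
      exact Submodule.zero_mem _
    · exact (mem_ker_comps_succ φ i t x).1 hx
    · rw [show x = 0 from hx, map_zero]
      exact Submodule.zero_mem _
    · exact (mem_ker_comps_succ φ i t _).1 (hξ i trivial _ _ hx)
  · intro f hf
    choose η hη hηf using fun i (ξ : kerPreserving φ i) =>
      exists_extend_kerPreserving φ hN i (hf i trivial) ξ.2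
    let ξ : ∀ i, kerPreserving φ i := fun i => Nat.rec 0 (fun i ξ => ⟨η i ξ, hη i ξ⟩) i
    let ξ' : ∀ i, V i →ₗ[k] V i := fun i => (ξ i).1
    exact ⟨ξ', fun i _ => (ξ i).2, funext fun i => hηf i (ξ i)⟩

theorem finrank_pi_kerPreserving [∀ i, FiniteDimensional k (V i)] {m N : ℕ}
    (hV : ∀ i, m < i → Subsingleton (V i)) (hN : ∀ i, LinearMap.ker (comps φ i N) = ⊤) :
    ∑ i ∈ Finset.range (m + 1), finrank k (kerPreserving φ i) =
      ∑ i ∈ Finset.range m, finrank k (kerLowering φ i) +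
        finrank k (LinearMap.ker (quiverCommutator φ)) := by
  have hA : ∀ i, m + 1 ≤ i → Subsingleton (V i →ₗ[k] V i) := fun i hi =>
    have := hV i hi
    inferInstance
  have hB : ∀ i, m ≤ i → Subsingleton (V i →ₗ[k] V (i + 1)) := fun i hi =>
    have := hV (i + 1) (Nat.lt_succ_of_le hi)
    inferInstance
  have := finiteDimensional_pi_nat (k := k) (m + 1) hA
  rw [← finrank_pi_nat_submodule (m + 1) hA, ← finrank_pi_nat_submodule m hB,
    ← map_quiverCommutator φ hN, ← finrank_map_add_finrank_inf_ker _ (quiverCommutator φ),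
    inf_eq_right.2 (ker_quiverCommutator_le φ)]

end Comps

theorem sum_range_sub_mul_add {κ : ℕ → ℕ} (hκ : Monotone κ) (h0 : κ 0 = 0) (m : ℕ) :
    ∑ t ∈ Finset.range m, (κ (t + 1) - κ t) * κ (t + 1) +
      ∑ t ∈ Finset.range m, (κ (t + 1) - κ t) * κ t = κ m ^ 2 := by
  induction m with
  | zero => simp [h0]
  | succ m ih =>
    rw [Finset.sum_range_succ, Finset.sum_range_succ, add_add_add_comm, ih]
    obtain ⟨c, hc⟩ := Nat.exists_eq_add_of_le (hκ m.le_succ)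
    rw [Nat.succ_eq_add_one] at hc
    rw [hc, Nat.add_sub_cancel_left]
    ring

theorem sum_Ico_kerJump {k : Type*} [Field k] (d : ℕ → ℕ)
    (φ : ∀ i : ℕ, (Fin (d i) → k) →ₗ[k] (Fin (d (i + 1)) → k)) (i t : ℕ) :
    ∑ s ∈ Ico 1 (t + 1), kerJump d φ s i = finrank k (LinearMap.ker (comps φ i t)) := by
  induction t with
  | zero => rw [ker_comps_zero, finrank_bot, Finset.Ico_self, Finset.sum_empty]
  | succ t ih =>
    rw [Finset.sum_Ico_succ_top (by omega), ih, kerJump, Nat.add_sub_cancel]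
    exact Nat.add_sub_cancel' (Submodule.finrank_mono (monotone_ker_comps φ i t.le_succ))

theorem sum_kerJump_mul {k : Type*} [Field k] (d : ℕ → ℕ)
    (φ : ∀ i : ℕ, (Fin (d i) → k) →ₗ[k] (Fin (d (i + 1)) → k)) (n i j : ℕ) :
    ∑ t ∈ Icc 1 n, ∑ s ∈ Ico 1 t, kerJump d φ s i * kerJump d φ t j =
      ∑ t ∈ Finset.range n, (finrank k (LinearMap.ker (comps φ j (t + 1))) -
        finrank k (LinearMap.ker (comps φ j t))) * finrank k (LinearMap.ker (comps φ i t)) := by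
  rw [← Finset.Ico_add_one_right_eq_Icc, Finset.sum_Ico_eq_sum_range, Nat.add_sub_cancel]
  refine Finset.sum_congr rfl fun t _ => ?_
  rw [← Finset.sum_mul, add_comm 1 t, sum_Ico_kerJump, mul_comm, kerJump, Nat.add_sub_cancel]

/-- The space of quiver endomorphisms of a representation `φ ∈ E(d)` of the
equioriented quiver `Δ_n` is a linear subspace of `⊕ᵢ End(k^{dᵢ})` of
dimension `Σᵢ dᵢ² − Σᵢ Σ_{s<t} d^{(s)}ᵢ (d^{(t)}ᵢ + d^{(t)}_{i-1})`
(stated additively to avoid truncated subtraction); equivalently, the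
`G_d`-orbit of `φ` has dimension `Σᵢ Σ_{s<t} d^{(s)}ᵢ (d^{(t)}ᵢ + d^{(t)}_{i-1})`.
(Dimension vectors are padded by zeros outside the vertex range `1, …, n`,
which also realizes the conventions `φ_j = 0` for `j ≥ n` and `d^{(t)}_0 = 0`.) -/
theorem dimension_of_quiver_endomorphism_algebra
    (k : Type*) [Field k] (n : ℕ) (hn : 1 ≤ n) (d : ℕ → ℕ)
    (hd0 : d 0 = 0) (hdn : ∀ j, n < j → d j = 0)
    (φ : ∀ i : ℕ, (Fin (d i) → k) →ₗ[k] (Fin (d (i + 1)) → k)) :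
    ∃ S : Submodule k (∀ i : ℕ, (Fin (d i) → k) →ₗ[k] (Fin (d i) → k)),
      (↑S = {ξ : ∀ i : ℕ, (Fin (d i) → k) →ₗ[k] (Fin (d i) → k) |
          ∀ i, (ξ (i + 1)) ∘ₗ (φ i) = (φ i) ∘ₗ (ξ i)}) ∧
      finrank k S
          + ∑ i ∈ Icc 1 n, ∑ t ∈ Icc 1 n, ∑ s ∈ Ico 1 t,
              kerJump d φ s i * (kerJump d φ t i + kerJump d φ t (i - 1))
        = ∑ i ∈ Icc 1 n, d i ^ 2 := by
  have hV : ∀ i, n < i → Subsingleton (Fin (d i) → k) := fun i hi => by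
    rw [hdn i hi]
    infer_instance
  have hN : ∀ i, LinearMap.ker (comps φ i n) = ⊤ := fun i => by
    rw [LinearMap.ker_eq_top]
    obtain rfl | hi := Nat.eq_zero_or_pos i
    · have : Subsingleton (Fin (d 0) → k) := by
        rw [hd0]
        infer_instance
      exact Subsingleton.elim _ _
    · have := hV (i + n) (by omega)
      exact Subsingleton.elim _ _
  have hP : ∀ i, finrank k (kerPreserving φ i) +
      ∑ t ∈ Icc 1 n, ∑ s ∈ Ico 1 t, kerJump d φ s i * kerJump d φ t i = d i ^ 2 := fun i => by
    have hn' : finrank k (LinearMap.ker (comps φ i n)) = d i := by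
      rw [hN, finrank_top, Module.finrank_fin_fun]
    rw [finrank_filteredHom (monotone_ker_comps φ i) (monotone_ker_comps φ i) (hN i)
      (ker_comps_zero φ i), sum_kerJump_mul]
    refine Eq.trans (sum_range_sub_mul_add (κ := fun t => finrank k (LinearMap.ker (comps φ i t)))
      (fun _ _ h => Submodule.finrank_mono (monotone_ker_comps φ i h)) ?_ n) (congrArg (· ^ 2) hn')
    rw [ker_comps_zero, finrank_bot]
  have hQ : ∀ i, finrank k (kerLowering φ i) =
      ∑ t ∈ Icc 1 n, ∑ s ∈ Ico 1 t, kerJump d φ s (i + 1) * kerJump d φ t i := fun i => by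
    rw [finrank_filteredHom (monotone_ker_comps φ i)
      (fun _ _ h => monotone_ker_comps φ (i + 1) (Nat.sub_le_sub_right h 1)) (hN i)
      (ker_comps_zero φ i), sum_kerJump_mul]
    rfl
  refine ⟨LinearMap.ker (quiverCommutator φ), Set.ext fun ξ => mem_ker_quiverCommutator φ ξ, ?_⟩
  have key := finrank_pi_kerPreserving φ hV hN
  have hP0 : finrank k (kerPreserving φ 0) = 0 := by
    have h := hP 0
    have h0 : d 0 ^ 2 = 0 := by rw [hd0, zero_pow two_ne_zero]
    omega
  rw [Finset.sum_range_succ', hP0, add_zero] at key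
  have shift : ∀ u : ℕ → ℕ, ∑ i ∈ Icc 1 n, u i = ∑ i ∈ Finset.range n, u (i + 1) := fun u => by
    rw [Finset.range_eq_Ico, Finset.sum_Ico_add' u 0 n 1, ← Finset.Ico_add_one_right_eq_Icc]
  rw [shift, shift, ← Finset.sum_congr rfl fun i _ => hP (i + 1), Finset.sum_add_distrib, key]
  simp only [mul_add, Finset.sum_add_distrib, Nat.add_sub_cancel, hQ]
  ring
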